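/- For every (r,ρ) ∈ NC, the dynamical systems ([0,1]_{F_{r,ρ}}^+, σ_{F_{r,ρ}}^+) and ([0,1]_{F_{r,ρ}}, σ_{F_{r,ρ}}) are topologically mixing. -/

import Mathlib

/-- A dynamical system is topologically mixing if for all nonempty open sets `U`, `V`
there is `n₀` such that `f^[n] '' U` meets `V` for every `n ≥ n₀`. -/
def TopologicallyMixing {X : Type} [TopologicalSpace X] (f : X → X) : Prop :=
  ∀ U V : Set X, IsOpen U → IsOpen V → U.Nonempty → V.Nonempty →
    ∃ n₀ : ℕ, ∀ n : ℕ, n₀ ≤ n → (f^[n] '' U ∩ V).Nonempty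

/-- A dynamical system is (topologically) transitive if for all nonempty open sets `U`, `V`
there is `n ≥ 0` such that `f^[n] '' U` meets `V`. -/
def TopologicallyTransitive {X : Type} [TopologicalSpace X] (f : X → X) : Prop :=
  ∀ U V : Set X, IsOpen U → IsOpen V → U.Nonempty → V.Nonempty →
    ∃ n : ℕ, (f^[n] '' U ∩ V).Nonempty
/-- The Mahavier product of a closed relation `F` on `X`: all forward `F`-orbits. -/
def MahavierPlus {X : Type} (F : Set (X × X)) : Set (ℕ → X) :=
  {x | ∀ i : ℕ, (x i, x (i+1)) ∈ F}

/-- The two-sided Mahavier product of a closed relation `F` on `X`. -/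
def MahavierTwo {X : Type} (F : Set (X × X)) : Set (ℤ → X) :=
  {x | ∀ i : ℤ, (x i, x (i+1)) ∈ F}

/-- The shift map `σ_F⁺` on the Mahavier product. -/
def shiftPlus {X : Type} (F : Set (X × X)) (x : ↥(MahavierPlus F)) : ↥(MahavierPlus F) :=
  ⟨fun i => x.1 (i+1), fun i => x.2 (i+1)⟩

/-- The shift map `σ_F` on the two-sided Mahavier product. -/
def shiftTwo {X : Type} (F : Set (X × X)) (x : ↥(MahavierTwo F)) : ↥(MahavierTwo F) :=
  ⟨fun i => x.1 (i+1), fun i => x.2 (i+1)⟩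

/-- The relation `F_{r,ρ}` on `[0,1]`: the union of the graphs of `x ↦ rx`, `x ↦ ρx`
and the identity. -/
def Frel (r ρ : ℝ) : Set (↥(Set.Icc (0:ℝ) 1) × ↥(Set.Icc (0:ℝ) 1)) :=
  {p | (p.2 : ℝ) = r * (p.1 : ℝ) ∨ (p.2 : ℝ) = ρ * (p.1 : ℝ) ∨ (p.2 : ℝ) = (p.1 : ℝ)}

/-- `(r,ρ) ∈ 𝒩𝒞`: `r` and `ρ` never connect. -/
def NeverConnect (r ρ : ℝ) : Prop :=
  0 < r ∧ r < 1 ∧ 1 < ρ ∧ ∀ k l : ℤ, r ^ k = ρ ^ l ↔ k = 0 ∧ l = 0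

open Filter Topology in
/-- The products `r ^ k * ρ ^ l` with natural exponents are dense in `(0, ∞)`. -/
theorem NeverConnect.exists_pow_mul_pow_mem_Ioo {r ρ : ℝ} (h : NeverConnect r ρ) {c d : ℝ}
    (hc : 0 < c) (hcd : c < d) : ∃ k l : ℕ, r ^ k * ρ ^ l ∈ Set.Ioo c d := by
  obtain ⟨hr0, hr1, hρ, hkl⟩ := h
  have hρ0 : 0 < ρ := by linarith
  have hlr : Real.log r < 0 := Real.log_neg hr0 hr1
  have hlρ : 0 < Real.log ρ := Real.log_pos hρ
  have hirr : Irrational (Real.log r / Real.log ρ) := by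
    rintro ⟨q, hq⟩
    have hq' : (q.den : ℝ) * Real.log r = q.num * Real.log ρ := by
      rw [eq_div_iff hlρ.ne'] at hq
      rw [← hq, ← mul_assoc]
      congr 1
      exact_mod_cast Rat.den_mul_eq_num q
    have hpow : r ^ (q.den : ℤ) = ρ ^ q.num := by
      apply Real.log_injOn_pos (Set.mem_Ioi.2 (by positivity)) (Set.mem_Ioi.2 (by positivity))
      rw [Real.log_zpow, Real.log_zpow]
      exact_mod_cast hq'
    have := ((hkl _ _).1 hpow).1
    exact q.den_ne_zero (by exact_mod_cast this)
  have : Fact (0 < Real.log ρ) := ⟨hlρ⟩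
  have hdense := (AddCircle.denseRange_zsmul_coe_iff (p := Real.log ρ)).2 hirr
  obtain ⟨y, hy⟩ : (Set.Ioo (Real.log c) (Real.log d)).Nonempty :=
    Set.nonempty_Ioo.2 (Real.log_lt_log hc hcd)
  have hclus : MapClusterPt (y : AddCircle (Real.log ρ)) atTop
      (fun n : ℕ => n • ((Real.log r : ℝ) : AddCircle (Real.log ρ))) := by
    rw [mapClusterPt_atTop_nsmul_iff_mem_topologicalClosure_zmultiples]
    exact hdense _
  have hopen : (fun x : ℝ => (x : AddCircle (Real.log ρ))) '' Set.Ioo (Real.log c) (Real.log d) ∈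
      𝓝 (y : AddCircle (Real.log ρ)) :=
    (QuotientAddGroup.isOpenMap_coe _ isOpen_Ioo).mem_nhds ⟨y, hy, rfl⟩
  obtain ⟨K, hK⟩ := exists_nat_gt (Real.log c / Real.log r)
  obtain ⟨n, hn, u, hu, hun⟩ := frequently_atTop.1 (mapClusterPt_iff_frequently.1 hclus _ hopen) K
  have hun' : (u : AddCircle (Real.log ρ)) = ((n • Real.log r : ℝ) : AddCircle (Real.log ρ)) := hun
  obtain ⟨m, hm⟩ := AddSubgroup.mem_zmultiples_iff.1 (QuotientAddGroup.eq_iff_sub_mem.1 hun')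
  rw [zsmul_eq_mul, nsmul_eq_mul] at hm
  have hnc : n * Real.log r < Real.log c :=
    (div_lt_iff_of_neg hlr).1 (hK.trans_le (Nat.cast_le.2 hn))
  have hm0 : 0 ≤ m := by
    have : (0 : ℝ) < m := pos_of_mul_pos_left (by linarith [hu.1]) hlρ.le
    exact_mod_cast this.le
  lift m to ℕ using hm0
  rw [Int.cast_natCast] at hm
  have hlog : Real.log (r ^ n * ρ ^ m) = u := by
    rw [Real.log_mul (by positivity) (by positivity), Real.log_pow, Real.log_pow]
    linarith
  have hpos : 0 < r ^ n * ρ ^ m := by positivity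
  exact ⟨n, m, (Real.log_lt_log_iff hc hpos).1 (hlog ▸ hu.1),
    (Real.log_lt_log_iff hpos (hc.trans hcd)).1 (hlog ▸ hu.2)⟩

/-- Basic neighbourhoods in the two-sided Mahavier product. -/
theorem MahavierTwo.exists_forall_dist_lt_mem {X : Type} [PseudoMetricSpace X] {F : Set (X × X)}
    {U : Set (MahavierTwo F)} (hU : IsOpen U) {x : MahavierTwo F} (hx : x ∈ U) :
    ∃ N : ℕ, ∃ ε > 0, ∀ z : MahavierTwo F,
      (∀ i : ℤ, |i| ≤ N → dist (z.1 i) (x.1 i) < ε) → z ∈ U := by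
  obtain ⟨W, hW, rfl⟩ := isOpen_induced_iff.1 hU
  obtain ⟨I, u, hu, hIu⟩ := isOpen_pi_iff.1 hW x.1 hx
  have hε : ∀ i ∈ I, ∃ ε > 0, Metric.ball (x.1 i) ε ⊆ u i := fun i hi =>
    Metric.isOpen_iff.1 (hu i hi).1 _ (hu i hi).2
  choose! e he hball using hε
  obtain ⟨ε, hε, hεe⟩ : ∃ ε > 0, ∀ i ∈ I, ε ≤ e i := by
    rcases I.eq_empty_or_nonempty with rfl | hI
    · exact ⟨1, one_pos, by simp⟩
    · exact ⟨I.inf' hI e, (Finset.lt_inf'_iff hI).2 he, fun i hi => Finset.inf'_le e hi⟩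
  refine ⟨I.sup Int.natAbs, ε, hε, fun z hz => hIu fun i hi => hball i hi ?_⟩
  refine (hz i ?_).trans_le (hεe i hi)
  rw [Int.abs_eq_natAbs]
  exact_mod_cast Finset.le_sup (f := Int.natAbs) hi

theorem MahavierTwo.iterate_shiftTwo_apply {X : Type} {F : Set (X × X)} (x : MahavierTwo F)
    (n : ℕ) (i : ℤ) : ((shiftTwo F)^[n] x).1 i = x.1 (i + n) := by
  induction n generalizing x with
  | zero => simp
  | succ n ih =>
    rw [Function.iterate_succ_apply, ih]
    simp only [shiftTwo, Nat.cast_succ, add_assoc]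

theorem MahavierTwo.translate_mem {X : Type} {F : Set (X × X)} {x : ℤ → X}
    (hx : x ∈ MahavierTwo F) (c : ℤ) : (fun i => x (i + c)) ∈ MahavierTwo F := fun i => by
  have := hx (i + c)
  rwa [add_right_comm] at this

theorem MahavierTwo.glue_mem {X : Type} {F : Set (X × X)} {x w : ℤ → X}
    (hx : x ∈ MahavierTwo F) (hw : w ∈ MahavierTwo F) {N : ℤ} (h : x N = w N) :
    (fun i => if i ≤ N then x i else w i) ∈ MahavierTwo F := fun i => by
  dsimp only
  rcases lt_trichotomy i N with hi | rfl | hi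
  · rw [if_pos hi.le, if_pos (by omega)]
    exact hx i
  · rw [if_pos le_rfl, if_neg (by omega), h]
    exact hw i
  · rw [if_neg (by omega), if_neg (by omega)]
    exact hw i

/-- If `F` is reflexive, a forward orbit extends to a two-sided one, constant to the left. -/
theorem MahavierPlus.extend_mem {X : Type} {F : Set (X × X)} (hF : ∀ a, (a, a) ∈ F) {x : ℕ → X}
    (hx : x ∈ MahavierPlus F) : (fun i : ℤ => x i.toNat) ∈ MahavierTwo F := fun i => by
  dsimp only
  rcases lt_or_ge i 0 with hi | hi
  · rw [show i.toNat = 0 by omega, show (i + 1).toNat = 0 by omega]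
    exact hF _
  · rw [show (i + 1).toNat = i.toNat + 1 by omega]
    exact hx _

/-- Mixing passes to factors. -/
theorem TopologicallyMixing.of_semiconj {X Y : Type} [TopologicalSpace X] [TopologicalSpace Y]
    {f : X → X} {g : Y → Y} {π : X → Y} (hf : TopologicallyMixing f) (hπ : Continuous π)
    (hsurj : Function.Surjective π) (h : Function.Semiconj π f g) : TopologicallyMixing g := by
  intro U V hU hV hUne hVne
  obtain ⟨n₀, hn₀⟩ := hf _ _ (hU.preimage hπ) (hV.preimage hπ) (hUne.preimage hsurj)
    (hVne.preimage hsurj)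
  refine ⟨n₀, fun n hn => ?_⟩
  obtain ⟨_, ⟨x, hxU, rfl⟩, hxV⟩ := hn₀ n hn
  exact ⟨π (f^[n] x), ⟨π x, hxU, ((h.iterate_right n) x).symm⟩, hxV⟩

/-- For reflexive `F`, mixing of the two-sided shift implies mixing of the one-sided shift. -/
theorem TopologicallyMixing.shiftPlus_of_shiftTwo {X : Type} [TopologicalSpace X]
    {F : Set (X × X)} (hF : ∀ a, (a, a) ∈ F) (h : TopologicallyMixing (shiftTwo F)) :
    TopologicallyMixing (shiftPlus F) := by
  let π : MahavierTwo F → MahavierPlus F := fun x => ⟨fun i => x.1 i, fun i => x.2 i⟩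
  refine h.of_semiconj (π := π) ?_ ?_ fun _ => rfl
  · refine Continuous.subtype_mk (continuous_pi fun i => ?_) _
    exact (continuous_apply (i : ℤ)).comp
      (continuous_subtype_val : Continuous fun x : MahavierTwo F => x.1)
  · exact fun x => ⟨⟨_, MahavierPlus.extend_mem hF x.2⟩, rfl⟩

theorem Frel.refl_mem (r ρ : ℝ) (a : Set.Icc (0 : ℝ) 1) : (a, a) ∈ Frel r ρ := Or.inr (Or.inr rfl)

/-- An orbit through a positive point is positive everywhere. -/
theorem Frel.orbit_pos {r ρ : ℝ} (hr : 0 < r) (hρ : 0 < ρ) {x : ℤ → Set.Icc (0 : ℝ) 1}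
    (hx : x ∈ MahavierTwo (Frel r ρ)) (h0 : 0 < (x 0 : ℝ)) (i : ℤ) : 0 < (x i : ℝ) := by
  have key (j : ℤ) : 0 < (x (j + 1) : ℝ) ↔ 0 < (x j : ℝ) := by
    rcases hx j with h | h | h <;> simp only at h <;> rw [h]
    · exact mul_pos_iff_of_pos_left hr
    · exact mul_pos_iff_of_pos_left hρ
  induction i with
  | zero => exact h0
  | succ i ih => exact (key _).2 ih
  | pred i ih => exact (key _).1 (by rwa [sub_add_cancel])

/-- Every nonempty open set contains an orbit with positive coordinates. -/
theorem Frel.exists_pos_mem {r ρ : ℝ} (hr : 0 < r) (hρ : 0 < ρ)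
    {U : Set (MahavierTwo (Frel r ρ))} (hU : IsOpen U) (hne : U.Nonempty) :
    ∃ x ∈ U, ∀ i, 0 < (x.1 i : ℝ) := by
  obtain ⟨x, hx⟩ := hne
  by_cases h : ∃ j, 0 < (x.1 j : ℝ)
  · obtain ⟨j, hj⟩ := h
    refine ⟨x, hx, fun i => ?_⟩
    simpa using orbit_pos hr hρ (MahavierTwo.translate_mem x.2 j) (by simpa using hj) (i - j)
  · obtain ⟨N, ε, hε, hz⟩ := MahavierTwo.exists_forall_dist_lt_mem hU hx
    have hδ : 0 < min (ε / 2) 1 := by positivity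
    refine ⟨⟨fun _ => ⟨min (ε / 2) 1, hδ.le, min_le_right _ _⟩, fun _ => refl_mem _ _ _⟩,
      hz _ fun i _ => ?_, fun _ => hδ⟩
    have hxi : (x.1 i : ℝ) = 0 := le_antisymm (not_lt.1 fun hi => h ⟨i, hi⟩) (x.1 i).2.1
    rw [Subtype.dist_eq, hxi, Real.dist_eq, sub_zero, abs_of_pos hδ]
    linarith [min_le_left (ε / 2) 1]

theorem Frel.scale_mem {r ρ : ℝ} {x : ℤ → Set.Icc (0 : ℝ) 1} (hx : x ∈ MahavierTwo (Frel r ρ))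
    (t : Set.Icc (0 : ℝ) 1) : (fun i => t * x i) ∈ MahavierTwo (Frel r ρ) := fun i => by
  rcases hx i with h | h | h <;> simp only at h
  · left; simp only [Set.Icc.coe_mul, h]; ring
  · right; left; simp only [Set.Icc.coe_mul, h]; ring
  · right; right; simp only [Set.Icc.coe_mul, h]

/-- Decrease `k` times, then increase `l` times, then stay put. -/
theorem Frel.exists_path {r ρ : ℝ} (hr : 0 < r) (hr1 : r < 1) (hρ : 1 < ρ)
    (a b : Set.Icc (0 : ℝ) 1) (k l : ℕ) (h : (b : ℝ) = a * (r ^ k * ρ ^ l)) :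
    ∃ p ∈ MahavierTwo (Frel r ρ), p 0 = a ∧ ∀ i : ℤ, (k + l : ℤ) ≤ i → p i = b := by
  have ha := a.2.1
  have hρ0 : 0 < ρ := by linarith
  let q : ℕ → ℝ := fun i => a * (r ^ min i k * ρ ^ min (i - k) l)
  have hq1 (i : ℕ) : q i ≤ 1 := by
    rcases le_total i k with hik | hik
    · simp only [q, min_eq_left hik, Nat.sub_eq_zero_of_le hik, Nat.zero_min, pow_zero, mul_one]
      exact mul_le_one₀ a.2.2 (by positivity) (pow_le_one₀ hr.le hr1.le)
    · refine le_trans ?_ b.2.2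
      rw [h]
      simp only [q, min_eq_right hik]
      gcongr
      · exact hρ.le
      · exact min_le_right _ _
  let p : ℕ → Set.Icc (0 : ℝ) 1 := fun i => ⟨q i, by positivity, hq1 i⟩
  have hp : p ∈ MahavierPlus (Frel r ρ) := fun i => by
    simp only [Frel, Set.mem_ofPred_eq, p, q]
    rcases lt_or_ge i k with hik | hik
    · left
      rw [min_eq_left hik.le, min_eq_left (Nat.succ_le_of_lt hik), Nat.sub_eq_zero_of_le hik.le,
        Nat.sub_eq_zero_of_le (Nat.succ_le_of_lt hik), Nat.succ_eq_add_one]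
      ring
    · right
      rw [min_eq_right hik, min_eq_right (hik.trans i.le_succ), Nat.sub_add_comm hik]
      rcases lt_or_ge (i - k) l with hl | hl
      · left
        rw [min_eq_left hl.le, min_eq_left (Nat.succ_le_of_lt hl), Nat.succ_eq_add_one]
        ring
      · right
        rw [min_eq_right hl, min_eq_right (hl.trans (Nat.le_succ _))]
  refine ⟨_, MahavierPlus.extend_mem (refl_mem r ρ) hp, Subtype.ext ?_, fun i hi => Subtype.ext ?_⟩
  · simp [p, q]
  · simp only [p, q]
    rw [min_eq_right (by omega), min_eq_right (by omega), h]

theorem NeverConnect.topologicallyMixing_shiftTwo {r ρ : ℝ} (hNC : NeverConnect r ρ) :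
    TopologicallyMixing (shiftTwo (Frel r ρ)) := by
  intro U V hU hV hUne hVne
  have hr := hNC.1
  have hρ := hNC.2.2.1
  obtain ⟨x, hxU, hx⟩ := Frel.exists_pos_mem hr (by linarith) hU hUne
  obtain ⟨y, hyV, hy⟩ := Frel.exists_pos_mem hr (by linarith) hV hVne
  obtain ⟨N, ε, hε, hzU⟩ := MahavierTwo.exists_forall_dist_lt_mem hU hxU
  obtain ⟨M, δ, hδ, hzV⟩ := MahavierTwo.exists_forall_dist_lt_mem hV hyV
  have ha := hx N
  have hb := hy (-M)
  set s := max (1 - δ) (1 / 2) with hs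
  have hs0 : 0 < s := by positivity
  have hs1 : s < 1 := by simp only [hs, max_lt_iff]; constructor <;> linarith
  have hsδ : 1 - δ ≤ s := le_max_left _ _
  obtain ⟨k, l, hlow, hupp⟩ := hNC.exists_pow_mul_pow_mem_Ioo
    (c := s * (y.1 (-M)) / x.1 N) (d := y.1 (-M) / x.1 N) (by positivity)
    ((div_lt_div_iff_of_pos_right ha).2 (mul_lt_of_lt_one_left hb hs1))
  rw [div_lt_iff₀ ha] at hlow
  rw [lt_div_iff₀ ha] at hupp
  have hρ0 : 0 < ρ := one_pos.trans hρ
  have hrρ : 0 < r ^ k * ρ ^ l := by positivity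
  let t : Set.Icc (0 : ℝ) 1 := ⟨r ^ k * ρ ^ l * x.1 N / y.1 (-M), by positivity,
    (div_le_one hb).2 hupp.le⟩
  have ht : 1 - δ < t := hsδ.trans_lt ((lt_div_iff₀ hb).2 hlow)
  obtain ⟨p, hp, hp0, hpt⟩ := Frel.exists_path hr hNC.2.1 hρ (x.1 N) (t * y.1 (-M)) k l (by
    simp only [Set.Icc.coe_mul, t]
    field_simp)
  refine ⟨N + M + k + l + 1, fun n hn => ?_⟩
  have hp' := MahavierTwo.translate_mem hp (-N)
  have hw := MahavierTwo.translate_mem (Frel.scale_mem y.2 t) (-n)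
  have hpw := MahavierTwo.glue_mem hp' hw (N := n - M) (by
    rw [hpt _ (by omega), show (n - M + -n : ℤ) = -M by ring])
  have hz := MahavierTwo.glue_mem x.2 hpw (N := N) (by
    rw [if_pos (by omega), add_neg_cancel, hp0])
  refine ⟨_, ⟨⟨_, hz⟩, hzU _ fun i hi => ?_, rfl⟩, hzV _ fun i hi => ?_⟩
  · dsimp only
    rw [if_pos (le_of_abs_le hi), dist_self]
    exact hε
  · have hval : ((shiftTwo (Frel r ρ))^[n] ⟨_, hz⟩).1 i = t * y.1 i := by
      have hi' := neg_le_of_abs_le hi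
      rw [MahavierTwo.iterate_shiftTwo_apply]
      dsimp only
      split_ifs with h1 h2
      · omega
      · rw [hpt _ (by omega), show i = -M by omega]
      · rw [add_neg_cancel_right]
    rw [hval, Subtype.dist_eq, Real.dist_eq, Set.Icc.coe_mul, abs_lt]
    have h0 := hy i
    have h1 := (y.1 i).2.2
    have h2 := t.2.2
    constructor <;> nlinarith

/-- For `(r,ρ) ∈ 𝒩𝒞`, the systems `([0,1]_{F_{r,ρ}}⁺, σ⁺)` and `([0,1]_{F_{r,ρ}}, σ)` are
topologically mixing. -/
theorem statement19 (r ρ : ℝ) (hNC : NeverConnect r ρ) :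
    TopologicallyMixing (shiftPlus (Frel r ρ)) ∧
    TopologicallyMixing (shiftTwo (Frel r ρ)) := by
  have h := hNC.topologicallyMixing_shiftTwo
  exact ⟨h.shiftPlus_of_shiftTwo (Frel.refl_mem r ρ), h⟩
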